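/- Let Γ₀ ≤ SO(2,1)⁰ be a Schottky group and let u : Γ₀ → ℝ³ be a cocycle such that the affine action of Γ₀ on ℝ³ given by γ·x = γx + u(γ) is properly discontinuous. Then either α_u(γ) > 0 for every nontrivial γ ∈ Γ₀, or α_u(γ) < 0 for every nontrivial γ ∈ Γ₀. -/

import Mathlib

open Matrix

noncomputable section

/-- The Lorentzian bilinear form on `ℝ³`: `B(v,w) = v₁w₁ + v₂w₂ − v₃w₃`. -/
def Bform (v w : Fin 3 → ℝ) : ℝ := v 0 * w 0 + v 1 * w 1 - v 2 * w 2

/-- `SO(2,1)⁰`: linear automorphisms of `ℝ³` preserving `B`, with determinant 1,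
preserving the future cone `{v | B(v,v) < 0, v₃ > 0}`. -/
def SO21 (γ : Matrix (Fin 3) (Fin 3) ℝ) : Prop :=
  (∀ v w : Fin 3 → ℝ, Bform (γ.mulVec v) (γ.mulVec w) = Bform v w) ∧
  γ.det = 1 ∧
  (∀ v : Fin 3 → ℝ, Bform v v < 0 → 0 < v 2 → 0 < γ.mulVec v 2)

/-- A matrix is hyperbolic if it has an eigenvalue `λ > 1`. -/
def IsHyperbolic (γ : Matrix (Fin 3) (Fin 3) ℝ) : Prop :=
  ∃ lam : ℝ, 1 < lam ∧ ∃ v : Fin 3 → ℝ, v ≠ 0 ∧ γ.mulVec v = lam • v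

/-- `x0` is the neutral vector of `γ`: fixed by `γ`, of unit `B`-norm, and such that
`det(x₋, x⁰, x₊) > 0` for (any) future-pointing eigenvectors `x₋, x₊` of `γ` for the
eigenvalues `λ > 1` and `λ⁻¹`. -/
def IsNeutral (γ : Matrix (Fin 3) (Fin 3) ℝ) (x0 : Fin 3 → ℝ) : Prop :=
  γ.mulVec x0 = x0 ∧ Bform x0 x0 = 1 ∧
  (∀ (lam : ℝ) (xm xp : Fin 3 → ℝ), 1 < lam → xm ≠ 0 → xp ≠ 0 →
    γ.mulVec xm = lam • xm → γ.mulVec xp = lam⁻¹ • xp →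
    0 < xm 2 → 0 < xp 2 → 0 < (Matrix.of ![xm, x0, xp]).det)

/-- The underlying matrix of an element of a subgroup of `GL(3,ℝ)`. -/
def toM {Γ₀ : Subgroup (Matrix (Fin 3) (Fin 3) ℝ)ˣ} (γ : Γ₀) : Matrix (Fin 3) (Fin 3) ℝ :=
  ((γ : (Matrix (Fin 3) (Fin 3) ℝ)ˣ) : Matrix (Fin 3) (Fin 3) ℝ)

/-- A Schottky group: a nonabelian discrete subgroup of `SO(2,1)⁰` all of whose
nontrivial elements are hyperbolic. -/
def IsSchottky (Γ₀ : Subgroup (Matrix (Fin 3) (Fin 3) ℝ)ˣ) : Prop :=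
  (∀ γ : Γ₀, SO21 (toM γ)) ∧
  DiscreteTopology Γ₀ ∧
  (∃ a b : Γ₀, a * b ≠ b * a) ∧
  (∀ γ : Γ₀, γ ≠ 1 → IsHyperbolic (toM γ))

/-- A cocycle `u : Γ₀ → ℝ³`, i.e. `u(γ₁γ₂) = u(γ₁) + γ₁ u(γ₂)`. -/
def IsCocycle (Γ₀ : Subgroup (Matrix (Fin 3) (Fin 3) ℝ)ˣ) (u : Γ₀ → Fin 3 → ℝ) : Prop :=
  ∀ γ₁ γ₂ : Γ₀, u (γ₁ * γ₂) = u γ₁ + (toM γ₁).mulVec (u γ₂)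

/-- The affine deformation `γ·x = γx + u(γ)` acts properly discontinuously on `ℝ³`. -/
def ProperlyDisc (Γ₀ : Subgroup (Matrix (Fin 3) (Fin 3) ℝ)ˣ) (u : Γ₀ → Fin 3 → ℝ) : Prop :=
  ∀ K : Set (Fin 3 → ℝ), IsCompact K →
    {γ : Γ₀ | ∃ x ∈ K, (toM γ).mulVec x + u γ ∈ K}.Finite


def d3 (a b c : Fin 3 → ℝ) : ℝ :=
  a 0 * (b 1 * c 2 - b 2 * c 1) - a 1 * (b 0 * c 2 - b 2 * c 0) + a 2 * (b 0 * c 1 - b 1 * c 0)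

lemma det_of_d3 (a b c : Fin 3 → ℝ) : (Matrix.of ![a, b, c]).det = d3 a b c := by
  simp [Matrix.det_fin_three, d3]; ring

lemma d3_basis (a b c : Fin 3 → ℝ) (h : d3 a b c ≠ 0) (v : Fin 3 → ℝ) :
    ∃ x y z : ℝ, v = x • a + y • b + z • c := by
  refine ⟨d3 v b c / d3 a b c, d3 a v c / d3 a b c, d3 a b v / d3 a b c, ?_⟩
  have key : d3 a b c • v = d3 v b c • a + d3 a v c • b + d3 a b v • c := by
    funext i
    fin_cases i <;> simp [d3] <;> ring
  have : v = (d3 a b c)⁻¹ • (d3 a b c • v) := by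
    rw [smul_smul, inv_mul_cancel₀ h, one_smul]
  refine this.trans ?_
  rw [key, smul_add, smul_add, smul_smul, smul_smul, smul_smul]
  simp only [div_eq_inv_mul]

lemma B_comm (a b : Fin 3 → ℝ) : Bform a b = Bform b a := by
  simp [Bform]; ring
lemma B_add_r (a b c : Fin 3 → ℝ) : Bform a (b + c) = Bform a b + Bform a c := by
  simp [Bform]; ring
lemma B_add_l (a b c : Fin 3 → ℝ) : Bform (b + c) a = Bform b a + Bform c a := by
  simp [Bform]; ring
lemma B_smul_r (r : ℝ) (a b : Fin 3 → ℝ) : Bform a (r • b) = r * Bform a b := by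
  simp [Bform]; ring
lemma B_smul_l (r : ℝ) (a b : Fin 3 → ℝ) : Bform (r • a) b = r * Bform a b := by
  simp [Bform]; ring

lemma gram (a b c : Fin 3 → ℝ) : d3 a b c ^ 2 =
    -(Bform a a * (Bform b b * Bform c c - Bform b c ^ 2)
      - Bform a b * (Bform a b * Bform c c - Bform b c * Bform a c)
      + Bform a c * (Bform a b * Bform b c - Bform b b * Bform a c)) := by
  simp only [d3, Bform]; ring

lemma null_fut {a c : Fin 3 → ℝ} (ha : Bform a a = 0) (hc : Bform c c = 0)
    (ha2 : 0 < a 2) (hc2 : 0 < c 2) : Bform a c ≤ 0 := by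
  simp only [Bform] at *
  have h : (a 0 * c 0 + a 1 * c 1) ^ 2 ≤ (a 2 * c 2) ^ 2 := by
    have e1 : (a 2 * c 2) ^ 2 = (a 0 * a 0 + a 1 * a 1) * (c 0 * c 0 + c 1 * c 1) := by
      have h1 : a 0 * a 0 + a 1 * a 1 = a 2 * a 2 := by linarith
      have h2 : c 0 * c 0 + c 1 * c 1 = c 2 * c 2 := by linarith
      rw [h1, h2]; ring
    rw [e1]
    nlinarith [sq_nonneg (a 0 * c 1 - a 1 * c 0)]
  have := abs_le_of_sq_le_sq' h (by positivity)
  linarith [this.2]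

lemma orient {e x c : Fin 3 → ℝ} (he : Bform e e = 0) (hc : Bform c c = 0) (hx : Bform x x = 1)
    (hex : Bform e x = 0) (hcx : Bform c x = 0) (he2 : 0 < e 2) (hc2 : 0 < c 2)
    (hD : 0 < d3 e x c) : d3 e x c = - Bform e c ∧ ∀ v, d3 e x v = - Bform e v := by
  have h0 : d3 e x c = - Bform e c := by
    have g := gram e x c
    rw [he, hc, hx, hex, B_comm x c, hcx] at g
    have h1 := null_fut he hc he2 hc2
    have h2 : (d3 e x c - Bform e c) * (d3 e x c + Bform e c) = 0 := by linarith
    rcases mul_eq_zero.1 h2 with h | h <;> linarith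
  refine ⟨h0, fun v => ?_⟩
  obtain ⟨p, q, r, rfl⟩ := d3_basis e x c hD.ne' v
  rw [B_add_r, B_add_r, B_smul_r, B_smul_r, B_smul_r, he, hex]
  have : d3 e x (p • e + q • x + r • c) = r * d3 e x c := by
    simp [d3]; ring
  rw [this, h0]; ring

/-- Affine data attached to an element. -/
structure AffD (M : Matrix (Fin 3) (Fin 3) ℝ) (w : Fin 3 → ℝ) (α lam : ℝ)
    (e x p : Fin 3 → ℝ) : Prop where
  lam_gt : 1 < lam
  ne : e ≠ 0
  null : Bform e e = 0
  eig : M.mulVec e = lam • e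
  fix : M.mulVec x = x
  ori : ∀ v, d3 e x v = - Bform e v
  orth : Bform e x = 0
  aff : M.mulVec p + w = p + α • x

lemma ne_two {v : Fin 3 → ℝ} (hv : v ≠ 0) (h : Bform v v = 0) : v 2 ≠ 0 := by
  intro h2
  apply hv
  simp only [Bform, h2] at h
  have h0 : v 0 = 0 := by nlinarith [sq_nonneg (v 0), sq_nonneg (v 1)]
  have h1 : v 1 = 0 := by nlinarith [sq_nonneg (v 0), sq_nonneg (v 1)]
  funext i; fin_cases i <;> simp [h0, h1, h2]

lemma eig_null {M : Matrix (Fin 3) (Fin 3) ℝ}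
    (hM : ∀ v w : Fin 3 → ℝ, Bform (M.mulVec v) (M.mulVec w) = Bform v w)
    {l : ℝ} (hl : 0 < l) (hl1 : l ≠ 1) {v : Fin 3 → ℝ} (hv : M.mulVec v = l • v) :
    Bform v v = 0 := by
  have := hM v v
  rw [hv, B_smul_l, B_smul_r] at this
  have h2 : (l - 1) * (l + 1) * Bform v v = 0 := by linarith
  rcases mul_eq_zero.1 h2 with h | h
  · rcases mul_eq_zero.1 h with h | h
    · exact absurd (by linarith) hl1
    · linarith
  · exact h

lemma eig_orth {M : Matrix (Fin 3) (Fin 3) ℝ}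
    (hM : ∀ v w : Fin 3 → ℝ, Bform (M.mulVec v) (M.mulVec w) = Bform v w)
    {l : ℝ} (hl1 : l ≠ 1) {v x : Fin 3 → ℝ} (hv : M.mulVec v = l • v) (hx : M.mulVec x = x) :
    Bform v x = 0 := by
  have := hM v x
  rw [hv, hx, B_smul_l] at this
  have h2 : (l - 1) * Bform v x = 0 := by linarith
  rcases mul_eq_zero.1 h2 with h | h
  · exact absurd (by linarith) hl1
  · exact h

lemma fut_eig {M : Matrix (Fin 3) (Fin 3) ℝ}
    (hM : ∀ v w : Fin 3 → ℝ, Bform (M.mulVec v) (M.mulVec w) = Bform v w)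
    {l : ℝ} (hl : 0 < l) (hl1 : l ≠ 1) {v : Fin 3 → ℝ} (hv0 : v ≠ 0) (hv : M.mulVec v = l • v) :
    ∃ e : Fin 3 → ℝ, e ≠ 0 ∧ 0 < e 2 ∧ M.mulVec e = l • e ∧ Bform e e = 0 := by
  have hn := eig_null hM hl hl1 hv
  rcases lt_or_gt_of_ne (ne_two hv0 hn) with h | h
  · refine ⟨-v, neg_ne_zero.2 hv0, by simpa using h, by rw [Matrix.mulVec_neg, hv, smul_neg], ?_⟩
    simpa [Bform] using hn
  · exact ⟨v, hv0, h, hv, hn⟩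

lemma contr_eig {M : Matrix (Fin 3) (Fin 3) ℝ}
    (hM : ∀ v w : Fin 3 → ℝ, Bform (M.mulVec v) (M.mulVec w) = Bform v w)
    {l : ℝ} (hl : 1 < l) {v : Fin 3 → ℝ} (hv0 : v ≠ 0) (hv : M.mulVec v = l • v) :
    ∃ c : Fin 3 → ℝ, c ≠ 0 ∧ M.mulVec c = l⁻¹ • c := by
  have hinj : ∀ a b : Fin 3 → ℝ, (∀ z, Bform a z = Bform b z) → a = b := by
    intro a b h
    have h0 := h ![1, 0, 0]
    have h1 := h ![0, 1, 0]
    have h2 := h ![0, 0, 1]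
    simp [Bform] at h0 h1 h2
    funext i; fin_cases i <;> simp [h0, h1, h2]
  have hMu : IsUnit M := by
    rw [← Matrix.mulVec_injective_iff_isUnit]
    intro a b hab
    apply hinj
    intro z
    rw [← hM a z, ← hM b z]
    rw [hab]
  have hdet : (M - l • (1 : Matrix (Fin 3) (Fin 3) ℝ)).det = 0 := by
    rw [← Matrix.exists_mulVec_eq_zero_iff]
    refine ⟨v, hv0, ?_⟩
    rw [Matrix.sub_mulVec, hv, Matrix.smul_mulVec, Matrix.one_mulVec, sub_self]
  obtain ⟨w, hw0, hw⟩ := Matrix.exists_vecMul_eq_zero_iff.2 hdet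
  rw [Matrix.vecMul_sub, Matrix.vecMul_smul, Matrix.vecMul_one, sub_eq_zero] at hw
  have hBw : ∀ z : Fin 3 → ℝ, Bform ![w 0, w 1, - w 2] z = w ⬝ᵥ z := by
    intro z; simp [Bform, dotProduct, Fin.sum_univ_three]
  refine ⟨![w 0, w 1, - w 2], ?_, ?_⟩
  · intro h
    apply hw0
    have h0 := congrFun h 0
    have h1 := congrFun h 1
    have h2 := congrFun h 2
    simp at h0 h1 h2
    funext i; fin_cases i <;> simp [h0, h1, h2]
  · apply hinj
    intro z
    obtain ⟨y, rfl⟩ := (Matrix.mulVec_surjective_iff_isUnit.2 hMu) z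
    rw [hM, B_smul_l, hBw, hBw, Matrix.dotProduct_mulVec, hw, smul_dotProduct, smul_eq_mul]
    field_simp

lemma exists_data {M N : Matrix (Fin 3) (Fin 3) ℝ} {w w1 : Fin 3 → ℝ}
    (hNM : N * M = 1) (hw1 : w1 + N.mulVec w = 0)
    (hM : ∀ v w : Fin 3 → ℝ, Bform (M.mulVec v) (M.mulVec w) = Bform v w)
    (hH : IsHyperbolic M) {x : Fin 3 → ℝ} (hx : IsNeutral M x) :
    ∃ lam e c p, AffD M w (Bform w x) lam e x p ∧ AffD N w1 (Bform w x) lam c (-x) p ∧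
      ∀ f, Bform f f = 0 → f ≠ 0 → Bform f e ≠ 0 ∨ Bform f c ≠ 0 := by
  obtain ⟨l, hl, v, hv0, hv⟩ := hH
  have hli : l⁻¹ < 1 := inv_lt_one_of_one_lt₀ hl
  have hlp : 0 < l := by linarith
  obtain ⟨e, he0, he2, he, hen⟩ := fut_eig hM hlp hl.ne' hv0 hv
  obtain ⟨c', hc0', hc'⟩ := contr_eig hM hl hv0 hv
  obtain ⟨c, hc0, hc2, hc, hcn⟩ := fut_eig hM (inv_pos.2 hlp) hli.ne hc0' hc'
  obtain ⟨hxf, hxx, hxd⟩ := hx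
  have hD := hxd l e c hl he0 hc0 he hc he2 hc2
  rw [det_of_d3] at hD
  have hex := eig_orth hM hl.ne' he hxf
  have hcx := eig_orth hM hli.ne hc hxf
  obtain ⟨hec, ho⟩ := orient hen hcn hxx hex hcx he2 hc2 hD
  have hnx : Bform (-x) (-x) = 1 := by simpa [Bform] using hxx
  have hcnx : Bform c (-x) = 0 := by
    have : Bform c (-x) = - Bform c x := by simp [Bform]; ring
    rw [this, hcx, neg_zero]
  have henx : Bform e (-x) = 0 := by
    have : Bform e (-x) = - Bform e x := by simp [Bform]; ring
    rw [this, hex, neg_zero]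
  have hD' : 0 < d3 c (-x) e := by
    have : d3 c (-x) e = d3 e x c := by simp [d3]; ring
    rw [this]; exact hD
  obtain ⟨-, ho'⟩ := orient hcn hen hnx hcnx henx hc2 he2 hD'
  obtain ⟨a, b, d, hw⟩ := d3_basis e x c hD.ne' w
  have hb : Bform w x = b := by
    rw [hw, B_add_l, B_add_l, B_smul_l, B_smul_l, B_smul_l, hex, hxx, hcx]; ring
  have hN : ∀ z, N.mulVec (M.mulVec z) = z := by
    intro z; rw [Matrix.mulVec_mulVec, hNM, Matrix.one_mulVec]
  have hNx : N.mulVec x = x := by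
    have := hN x; rwa [hxf] at this
  have hNc : N.mulVec c = l • c := by
    have := hN c
    rw [hc, Matrix.mulVec_smul] at this
    have h2 : l • (l⁻¹ • N.mulVec c) = l • c := by rw [this]
    rwa [smul_smul, mul_inv_cancel₀ hlp.ne', one_smul] at h2
  have hl1 : l - 1 ≠ 0 := by linarith
  have hl2 : l⁻¹ - 1 ≠ 0 := by linarith
  let p : Fin 3 → ℝ := (- a / (l - 1)) • e + (- d / (l⁻¹ - 1)) • c
  have hp : M.mulVec p + w = p + b • x := by
    simp only [p]
    rw [Matrix.mulVec_add, Matrix.mulVec_smul, Matrix.mulVec_smul, he, hc]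
    conv_lhs => rw [hw]
    have h1 : (-a / (l - 1)) * l + a = -a / (l - 1) := by field_simp; ring
    have h2 : (-d / (l⁻¹ - 1)) * l⁻¹ + d = -d / (l⁻¹ - 1) := by
      generalize l⁻¹ = k at hl2; field_simp; ring
    funext i
    simp only [Pi.add_apply, Pi.smul_apply, smul_eq_mul]
    linear_combination e i * h1 + c i * h2
  clear_value p
  refine ⟨l, e, c, p, ?_, ?_, ?_⟩
  · rw [hb]
    exact ⟨hl, he0, hen, he, hxf, ho, hex, hp⟩
  · rw [hb]
    refine ⟨hl, hc0, hcn, hNc, by rw [Matrix.mulVec_neg, hNx], ho', hcnx, ?_⟩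
    have h3 := congrArg N.mulVec hp
    rw [Matrix.mulVec_add, Matrix.mulVec_add, hN, Matrix.mulVec_smul, hNx] at h3
    have h4 : w1 = - N.mulVec w := eq_neg_of_add_eq_zero_left hw1
    rw [h4]
    funext i
    have h5 := congrFun h3 i
    simp only [Pi.add_apply, Pi.smul_apply, Pi.neg_apply, smul_eq_mul] at h5 ⊢
    linarith
  · intro f hf hf0
    by_contra hcon
    push Not at hcon
    obtain ⟨h1, h2⟩ := hcon
    have hecne : Bform e c ≠ 0 := by intro h; rw [h] at hec; linarith
    obtain ⟨a', b', d', rfl⟩ := d3_basis e x c hD.ne' f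
    rw [B_add_l, B_add_l, B_smul_l, B_smul_l, B_smul_l, hen, B_comm x e, hex, B_comm c e] at h1
    rw [B_add_l, B_add_l, B_smul_l, B_smul_l, B_smul_l, hcn, B_comm x c, hcx] at h2
    have hd : d' = 0 := by
      have : d' * Bform e c = 0 := by linarith
      exact (mul_eq_zero.1 this).resolve_right hecne
    have ha : a' = 0 := by
      have : a' * Bform e c = 0 := by linarith
      exact (mul_eq_zero.1 this).resolve_right hecne
    subst hd ha
    simp only [zero_smul, zero_add, add_zero] at hf hf0
    rw [B_smul_l, B_smul_r, hxx] at hf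
    have : b' = 0 := by nlinarith
    subst this
    simp at hf0

section act
variable {Γ₀ : Subgroup (Matrix (Fin 3) (Fin 3) ℝ)ˣ} {u : Γ₀ → Fin 3 → ℝ}

def act (u : Γ₀ → Fin 3 → ℝ) (g : Γ₀) (x : Fin 3 → ℝ) : Fin 3 → ℝ := (toM g).mulVec x + u g

lemma toM_mul (a b : Γ₀) : toM (a * b) = toM a * toM b := by simp [toM]
lemma toM_one : toM (1 : Γ₀) = 1 := by simp [toM]

lemma u_one (hu : IsCocycle Γ₀ u) : u 1 = 0 := by
  have := hu 1 1
  rw [mul_one, toM_one, Matrix.one_mulVec] at this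
  simpa using this

lemma act_mul (hu : IsCocycle Γ₀ u) (a b : Γ₀) (x : Fin 3 → ℝ) :
    act u (a * b) x = act u a (act u b x) := by
  simp only [act]
  rw [hu, toM_mul, Matrix.mulVec_add, Matrix.mulVec_mulVec]
  abel

lemma act_one (hu : IsCocycle Γ₀ u) (x : Fin 3 → ℝ) : act u 1 x = x := by
  simp [act, u_one hu, toM_one]

lemma act_pow (hu : IsCocycle Γ₀ u) {g : Γ₀} {α l : ℝ} {e x p : Fin 3 → ℝ}
    (h : AffD (toM g) (u g) α l e x p) (m : ℕ) (s t : ℝ) :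
    act u (g ^ m) (p + s • x + t • e) = p + (s + m * α) • x + (l ^ m * t) • e := by
  induction m with
  | zero => simp [act_one hu]
  | succ m ih =>
    rw [pow_succ', act_mul hu, ih]
    have h1 := h.aff
    simp only [act]
    rw [Matrix.mulVec_add, Matrix.mulVec_add, Matrix.mulVec_smul, Matrix.mulVec_smul, h.fix, h.eig]
    funext i
    have h2 := congrFun h1 i
    simp only [Pi.add_apply, Pi.smul_apply, smul_eq_mul] at h2 ⊢
    push_cast
    rw [pow_succ]
    linear_combination h2

lemma toM_pow_eig {g : Γ₀} {l : ℝ} {e : Fin 3 → ℝ} (h : (toM g).mulVec e = l • e) (m : ℕ) :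
    (toM (g ^ m)).mulVec e = l ^ m • e := by
  induction m with
  | zero => simp [toM_one]
  | succ m ih =>
    rw [pow_succ', toM_mul, ← Matrix.mulVec_mulVec, ih, Matrix.mulVec_smul, h, smul_smul, pow_succ]

lemma alpha_ne (hu : IsCocycle Γ₀ u) (hPD : ProperlyDisc Γ₀ u) {g : Γ₀} {l : ℝ}
    {e x p : Fin 3 → ℝ} (h : AffD (toM g) (u g) 0 l e x p) : False := by
  have hfin := hPD {p} isCompact_singleton
  have hmem : ∀ m : ℕ, g ^ m ∈ {γ : Γ₀ | ∃ x ∈ ({p} : Set (Fin 3 → ℝ)),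
      (toM γ).mulVec x + u γ ∈ ({p} : Set (Fin 3 → ℝ))} := by
    intro m
    refine ⟨p, rfl, ?_⟩
    have := act_pow hu h m 0 0
    simpa [act] using this
  obtain ⟨m, n, hmn, heq⟩ := Set.Finite.exists_lt_map_eq_of_forall_mem hmem hfin
  have h1 := toM_pow_eig h.eig m
  have h2 := toM_pow_eig h.eig n
  rw [heq, h2] at h1
  have h3 := smul_left_injective ℝ h.ne h1
  have := pow_lt_pow_right₀ h.lam_gt hmn
  linarith

lemma bern {l : ℝ} (hl : 1 < l) (n : ℕ) : (n : ℝ) * (l ^ n)⁻¹ ≤ (l - 1)⁻¹ := by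
  have h := one_add_mul_le_pow (a := l - 1) (by linarith) n
  have h1 : 0 < l - 1 := by linarith
  have hp : 0 < l ^ n := by positivity
  rw [← div_eq_mul_inv, div_le_iff₀ hp, inv_mul_eq_div, le_div_iff₀ h1]
  have : 1 + (l - 1) = l := by ring
  rw [this] at h
  linarith

lemma affine_bdd {l : ℝ} (hl : 1 < l) (a b : ℝ) (n : ℕ) (y : ℝ) (hy : |y| ≤ a * n + b)
    (ha : 0 ≤ a) (hb : 0 ≤ b) : |(l ^ n)⁻¹ * y| ≤ a * (l - 1)⁻¹ + b := by
  have h := bern hl n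
  have hp : 0 < (l ^ n)⁻¹ := by positivity
  have h1 : (l ^ n)⁻¹ ≤ 1 := inv_le_one_of_one_le₀ (one_le_pow₀ hl.le)
  rw [abs_mul, abs_of_pos hp]
  calc (l ^ n)⁻¹ * |y| ≤ (l ^ n)⁻¹ * (a * n + b) := by gcongr
    _ = a * (n * (l ^ n)⁻¹) + b * (l ^ n)⁻¹ := by ring
    _ ≤ a * (l - 1)⁻¹ + b * 1 := by gcongr
    _ = _ := by ring

lemma opp (hu : IsCocycle Γ₀ u) (hPD : ProperlyDisc Γ₀ u) {g h : Γ₀}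
    (hB : ∀ (k : Γ₀) (v w : Fin 3 → ℝ), Bform ((toM k).mulVec v) ((toM k).mulVec w) = Bform v w)
    {α β l μ : ℝ}
    {e x p f y q : Fin 3 → ℝ} (hg : AffD (toM g) (u g) α l e x p)
    (hh : AffD (toM h) (u h) β μ f y q) (hef : Bform e f ≠ 0) (hα : 0 < α) (hβ : β < 0) :
    False := by
  have hD : d3 x e f ≠ 0 := by
    have : d3 x e f = - d3 e x f := by simp [d3]; ring
    rw [this, hg.ori, neg_neg]; exact hef
  have hsum : d3 (x + y) e f = 0 := by
    have : d3 (x + y) e f = - d3 e x f + d3 f y e := by simp [d3]; ring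
    rw [this, hg.ori, hh.ori, B_comm f e]; ring
  obtain ⟨k, r, s, hxy⟩ := d3_basis x e f hD (x + y)
  have hk : k = 0 := by
    rw [hxy] at hsum
    have : d3 (k • x + r • e + s • f) e f = k * d3 x e f := by simp [d3]; ring
    rw [this] at hsum
    exact (mul_eq_zero.1 hsum).resolve_right hD
  subst hk
  obtain ⟨A, b, c, hpq⟩ := d3_basis x e f hD (p - q)
  let n : ℕ → ℕ := fun m => ⌊(m * α) / (-β)⌋₊
  have hβ' : 0 < -β := by linarith
  have hn1 : ∀ m : ℕ, (n m : ℝ) * (-β) ≤ m * α := by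
    intro m
    rw [← le_div_iff₀ hβ']
    exact Nat.floor_le (by positivity)
  have hn2 : ∀ m : ℕ, m * α ≤ (n m + 1 : ℝ) * (-β) := by
    intro m
    rw [← div_le_iff₀ hβ']
    exact (Nat.lt_floor_add_one _).le
  let τ : ℕ → ℝ := fun m => - (m * α) - A
  let X : ℕ → Fin 3 → ℝ := fun m => p + (0 : ℝ) • x + ((l ^ m)⁻¹ * (τ m * r - b)) • e
  let Y : ℕ → Fin 3 → ℝ := fun m =>
    q + (τ m - n m * β) • y + ((μ ^ (n m))⁻¹ * (c - τ m * s)) • f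
  have hl0 : 0 < l := by linarith [hg.lam_gt]
  have hμ0 : 0 < μ := by linarith [hh.lam_gt]
  have hz : ∀ m, act u (g ^ m) (X m) = act u (h ^ (n m)) (Y m) := by
    intro m
    simp only [X, Y]
    rw [act_pow hu hg, act_pow hu hh, mul_inv_cancel_left₀ (by positivity),
      mul_inv_cancel_left₀ (by positivity)]
    funext i
    have h1 := congrFun hxy i
    have h2 := congrFun hpq i
    simp only [Pi.add_apply, Pi.sub_apply, Pi.smul_apply, smul_eq_mul] at h1 h2 ⊢
    simp only [τ]
    linear_combination h2 + ((m * α) + A) * h1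
  have hXY : ∀ m, act u ((g ^ m)⁻¹ * h ^ (n m)) (Y m) = X m := by
    intro m
    rw [act_mul hu, ← hz, ← act_mul hu, inv_mul_cancel, act_one hu]
  -- bounds
  have hτ1 : ∀ m : ℕ, |τ m| ≤ α * m + |A| := by
    intro m
    calc |τ m| ≤ |-(m * α)| + |A| := abs_sub _ _
      _ = α * m + |A| := by rw [abs_neg, abs_of_nonneg (by positivity)]; ring
  have hτ2 : ∀ m : ℕ, |τ m| ≤ (-β) * n m + (-β + |A|) := by
    intro m
    have := hτ1 m
    have := hn2 m
    linarith
  have hXb : ∀ m, |(l ^ m)⁻¹ * (τ m * r - b)| ≤ (α * |r|) * (l - 1)⁻¹ + (|A| * |r| + |b|) := by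
    intro m
    apply affine_bdd hg.lam_gt _ _ _ _ _ (by positivity) (by positivity)
    calc |τ m * r - b| ≤ |τ m * r| + |b| := abs_sub _ _
      _ = |τ m| * |r| + |b| := by rw [abs_mul]
      _ ≤ (α * m + |A|) * |r| + |b| := by gcongr; exact hτ1 m
      _ = _ := by ring
  have hYb : ∀ m, |(μ ^ (n m))⁻¹ * (c - τ m * s)| ≤
      ((-β) * |s|) * (μ - 1)⁻¹ + ((-β + |A|) * |s| + |c|) := by
    intro m
    apply affine_bdd hh.lam_gt _ _ _ _ _ (by positivity) (by positivity)
    calc |c - τ m * s| ≤ |c| + |τ m * s| := abs_sub _ _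
      _ = |τ m| * |s| + |c| := by rw [abs_mul]; ring
      _ ≤ ((-β) * n m + (-β + |A|)) * |s| + |c| := by gcongr; exact hτ2 m
      _ = _ := by ring
  have hYb2 : ∀ m, |τ m - n m * β| ≤ -β + |A| := by
    intro m
    have h1 := hn1 m
    have h2 := hn2 m
    have : τ m - n m * β = -(m * α + n m * β) - A := by simp only [τ]; ring
    rw [this]
    refine (abs_sub _ _).trans ?_
    gcongr
    rw [abs_neg, abs_le]
    constructor <;> linarith
  obtain ⟨R1, hR1⟩ : ∃ R1, ∀ m, ‖X m‖ ≤ R1 := by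
    refine ⟨‖p‖ + ((α * |r|) * (l - 1)⁻¹ + (|A| * |r| + |b|)) * ‖e‖, fun m => ?_⟩
    simp only [X, zero_smul, add_zero]
    refine (norm_add_le _ _).trans ?_
    rw [norm_smul, Real.norm_eq_abs]
    gcongr
    exact hXb m
  obtain ⟨R2, hR2⟩ : ∃ R2, ∀ m, ‖Y m‖ ≤ R2 := by
    refine ⟨‖q‖ + (-β + |A|) * ‖y‖ +
      (((-β) * |s|) * (μ - 1)⁻¹ + ((-β + |A|) * |s| + |c|)) * ‖f‖, fun m => ?_⟩
    simp only [Y]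
    refine (norm_add₃_le).trans ?_
    rw [norm_smul, norm_smul, Real.norm_eq_abs, Real.norm_eq_abs]
    gcongr
    · exact hYb2 m
    · exact hYb m
  have hfin := hPD (Metric.closedBall 0 (max R1 R2)) (isCompact_closedBall _ _)
  have hmem : ∀ m : ℕ, (g ^ m)⁻¹ * h ^ (n m) ∈ {γ : Γ₀ | ∃ x ∈ Metric.closedBall 0 (max R1 R2),
      (toM γ).mulVec x + u γ ∈ Metric.closedBall 0 (max R1 R2)} := by
    intro m
    refine ⟨Y m, ?_, ?_⟩
    · rw [mem_closedBall_zero_iff]; exact (hR2 m).trans (le_max_right _ _)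
    · have := hXY m
      simp only [act] at this
      rw [this, mem_closedBall_zero_iff]; exact (hR1 m).trans (le_max_left _ _)
  obtain ⟨m, m', hmm, heq⟩ := Set.Finite.exists_lt_map_eq_of_forall_mem hmem hfin
  have hnn : n m ≤ n m' := by
    apply Nat.floor_mono
    have : (m : ℝ) ≤ m' := by exact_mod_cast hmm.le
    gcongr
  obtain ⟨a, rfl⟩ := Nat.exists_eq_add_of_lt hmm
  obtain ⟨d, hd⟩ := Nat.exists_eq_add_of_le hnn
  have hpow : g ^ (a + 1) = h ^ d := by
    have e1 : n (m + a + 1) = d + n m := by rw [hd]; ring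
    have e2 : m + a + 1 = m + (a + 1) := rfl
    rw [e1, e2, pow_add g, pow_mul_comm g m (a + 1), pow_add h, _root_.mul_inv_rev, ← mul_assoc,
      mul_assoc ((g ^ m)⁻¹)] at heq
    have h1 : h ^ n m = (g ^ (a + 1))⁻¹ * (h ^ d * h ^ n m) := by
      simpa [mul_assoc] using heq
    rw [← mul_assoc, right_eq_mul, inv_mul_eq_one] at h1
    exact h1
  have h1 := toM_pow_eig hg.eig (a + 1)
  have h2 := toM_pow_eig hh.eig d
  rw [← hpow] at h2
  have h3 := hB (g ^ (a + 1)) e f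
  rw [h1, h2, B_smul_l, B_smul_r] at h3
  have h4 : 1 < l ^ (a + 1) := one_lt_pow₀ hg.lam_gt (by omega)
  have h5 : 1 ≤ μ ^ d := one_le_pow₀ hh.lam_gt.le
  have h6 : (l ^ (a + 1) * μ ^ d - 1) * Bform e f = 0 := by linarith
  rcases mul_eq_zero.1 h6 with h | h
  · nlinarith
  · exact hef h

end act

/-- Opposite Sign Lemma: if the affine deformation of a Schottky group by a
cocycle `u` is properly discontinuous, then the Margulis invariant `α_u` is either positive
on all nontrivial elements or negative on all nontrivial elements. -/
theorem stmt_13 (Γ₀ : Subgroup (Matrix (Fin 3) (Fin 3) ℝ)ˣ) (hS : IsSchottky Γ₀)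
    (u : Γ₀ → Fin 3 → ℝ) (hu : IsCocycle Γ₀ u) (hPD : ProperlyDisc Γ₀ u) :
    (∀ γ : Γ₀, γ ≠ 1 → ∀ x0 : Fin 3 → ℝ, IsNeutral (toM γ) x0 → 0 < Bform (u γ) x0) ∨
    (∀ γ : Γ₀, γ ≠ 1 → ∀ x0 : Fin 3 → ℝ, IsNeutral (toM γ) x0 → Bform (u γ) x0 < 0) := by
  obtain ⟨hSO, -, -, hHyp⟩ := hS
  have hB : ∀ (k : Γ₀) (v w : Fin 3 → ℝ),
      Bform ((toM k).mulVec v) ((toM k).mulVec w) = Bform v w := fun k => (hSO k).1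
  have data : ∀ γ : Γ₀, γ ≠ 1 → ∀ x : Fin 3 → ℝ, IsNeutral (toM γ) x →
      ∃ lam e c p, AffD (toM γ) (u γ) (Bform (u γ) x) lam e x p ∧
        AffD (toM γ⁻¹) (u γ⁻¹) (Bform (u γ) x) lam c (-x) p ∧
        ∀ f, Bform f f = 0 → f ≠ 0 → Bform f e ≠ 0 ∨ Bform f c ≠ 0 := by
    intro γ hγ x hx
    refine exists_data ?_ ?_ (hB γ) (hHyp γ hγ) hx
    · rw [← toM_mul, inv_mul_cancel, toM_one]
    · rw [← hu, inv_mul_cancel, u_one hu]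
  by_contra hcon
  rw [not_or] at hcon
  obtain ⟨h1, h2⟩ := hcon
  push Not at h1 h2
  obtain ⟨h, hh1, y, hy, hβ⟩ := h1
  obtain ⟨g, hg1, x, hx, hα⟩ := h2
  obtain ⟨l, e, c, p, hg, -, -⟩ := data g hg1 x hx
  obtain ⟨l', e', c', p', hh, hh', hor⟩ := data h hh1 y hy
  have hα' : 0 < Bform (u g) x := by
    refine lt_of_le_of_ne hα fun h0 => ?_
    rw [← h0] at hg
    exact alpha_ne hu hPD hg
  have hβ' : Bform (u h) y < 0 := by
    refine lt_of_le_of_ne hβ fun h0 => ?_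
    rw [h0] at hh
    exact alpha_ne hu hPD hh
  rcases hor e hg.null hg.ne with hne | hne
  · exact opp hu hPD hB hg hh hne hα' hβ'
  · exact opp hu hPD hB hg hh' hne hα' hβ'

end
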